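/- Let μ̃ be the probability measure with F_{μ̃}(z) = F_{μ₃}(w₃(z + 2√2·σ₁·i)) for z ∈ ℂ⁺. Suppose there exist c > 0 and functions ψ₁, ψ̃, ψ₃ : {Im u > c} → ℂ⁺ which are two-sided inverses of F_{μ₁}, F_{μ̃}, F_{μ₃} respectively, in the sense that F(ψ(u)) = u for Im u > c and ψ(F(w)) = w for Im w > c. Then there exists Y > 0 such that for every z with Im z > Y, setting u := F_{μ₃}(w₃(z)), one has ψ₁(u) + ψ̃(u) = ψ₃(u) + u − 2√2·σ₁·i. (This identity of Voiculescu transforms expresses that μ₁ ⊞ μ̃ = μ₃ ⊞ C, where C is the Cauchy distribution with parameter 2√2·σ₁, whose Voiculescu transform is the constant −2√2·σ₁·i.) -/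

import Mathlib

open MeasureTheory Filter

/-- The Cauchy transform `G_μ(z) = ∫ (z - t)⁻¹ dμ(t)` of a measure on `ℝ`. -/
noncomputable def cauchyG (μ : Measure ℝ) (z : ℂ) : ℂ := ∫ t, (z - (t : ℂ))⁻¹ ∂μ

/-- The reciprocal Cauchy transform `F_μ(z) = 1/G_μ(z)`. -/
noncomputable def cauchyF (μ : Measure ℝ) (z : ℂ) : ℂ := (cauchyG μ z)⁻¹

/-- `h_μ(z) = z - F_μ(z)`. -/
noncomputable def hTrans (μ : Measure ℝ) (z : ℂ) : ℂ := z - cauchyF μ z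

/-- The fixed point map `T_z(w) = h_{μ₁}(F_{μ₃}(w) + w - z) + z` of the additive
free deconvolution. -/
noncomputable def Tadd (μ₁ μ₃ : Measure ℝ) (z w : ℂ) : ℂ :=
  hTrans μ₁ (cauchyF μ₃ w + w - z) + z

/-- The reciprocal Cauchy transform of a probability measure increases imaginary parts. -/
lemma im_le_im_cauchyF (μ : Measure ℝ) [IsProbabilityMeasure μ] (w : ℂ) (hw : 0 < w.im) :
    w.im ≤ (cauchyF μ w).im := by
  have hne : ∀ t : ℝ, w - (t : ℂ) ≠ 0 := by
    intro t h
    have := congrArg Complex.im h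
    simp at this
    linarith
  have hcont : Continuous (fun t : ℝ => (w - (t : ℂ))⁻¹) :=
    Continuous.inv₀ (by fun_prop) hne
  have hbd : ∀ t : ℝ, ‖(w - (t : ℂ))⁻¹‖ ≤ w.im⁻¹ := by
    intro t
    rw [norm_inv]
    apply inv_anti₀ hw
    have := Complex.abs_im_le_norm (w - (t : ℂ))
    simp at this
    exact (le_abs_self _).trans this
  have hint : Integrable (fun t : ℝ => (w - (t : ℂ))⁻¹) μ :=
    Integrable.of_bound hcont.aestronglyMeasurable _ (Eventually.of_forall hbd)
  have hint2 : Integrable (fun t : ℝ => ‖(w - (t : ℂ))⁻¹‖ ^ 2) μ := by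
    refine Integrable.of_bound (hcont.norm.pow 2).aestronglyMeasurable (w.im⁻¹ ^ 2)
      (Eventually.of_forall fun t => ?_)
    rw [Real.norm_of_nonneg (by positivity)]
    exact pow_le_pow_left₀ (norm_nonneg _) (hbd t) 2
  have him : (cauchyG μ w).im = - (w.im * ∫ t : ℝ, ‖(w - (t : ℂ))⁻¹‖ ^ 2 ∂μ) := by
    unfold cauchyG
    have h1 : (∫ t : ℝ, (w - (t : ℂ))⁻¹ ∂μ).im = ∫ t : ℝ, ((w - (t : ℂ))⁻¹).im ∂μ :=
      (integral_im hint).symm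
    rw [h1, ← integral_const_mul, ← integral_neg]
    congr 1
    ext t
    rw [Complex.inv_im, norm_inv, Complex.normSq_eq_norm_sq]
    simp
    ring
  have hpos : 0 < ∫ t : ℝ, ‖(w - (t : ℂ))⁻¹‖ ^ 2 ∂μ := by
    rw [integral_pos_iff_support_of_nonneg (fun t => by positivity) hint2]
    have : Function.support (fun t : ℝ => ‖(w - (t : ℂ))⁻¹‖ ^ 2) = Set.univ := by
      ext t
      simpa using hne t
    rw [this]
    simp
  have hsq : ‖cauchyG μ w‖ ^ 2 ≤ ∫ t : ℝ, ‖(w - (t : ℂ))⁻¹‖ ^ 2 ∂μ := by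
    set m := ∫ t : ℝ, ‖(w - (t : ℂ))⁻¹‖ ∂μ with hm
    have h1 : ‖cauchyG μ w‖ ≤ m := norm_integral_le_integral_norm _
    have h2 : 0 ≤ ∫ t : ℝ, (‖(w - (t : ℂ))⁻¹‖ - m) ^ 2 ∂μ :=
      integral_nonneg fun t => sq_nonneg _
    have h3 : ∫ t : ℝ, (‖(w - (t : ℂ))⁻¹‖ - m) ^ 2 ∂μ
        = (∫ t : ℝ, ‖(w - (t : ℂ))⁻¹‖ ^ 2 ∂μ) - 2 * m * m + m ^ 2 := by
      have : ∀ t : ℝ, (‖(w - (t : ℂ))⁻¹‖ - m) ^ 2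
          = ‖(w - (t : ℂ))⁻¹‖ ^ 2 - 2 * m * ‖(w - (t : ℂ))⁻¹‖ + m ^ 2 := fun t => by ring
      simp_rw [this]
      have hi : Integrable (fun t : ℝ =>
          ‖(w - (t : ℂ))⁻¹‖ ^ 2 - 2 * m * ‖(w - (t : ℂ))⁻¹‖) μ :=
        hint2.sub (hint.norm.const_mul _)
      rw [integral_add hi (integrable_const _),
        integral_sub hint2 (hint.norm.const_mul _), integral_const_mul, ← hm]
      simp
    have h4 := pow_le_pow_left₀ (norm_nonneg _) h1 2
    nlinarith
  have hG : cauchyG μ w ≠ 0 := by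
    intro h
    rw [h] at him
    simp only [Complex.zero_im] at him
    nlinarith [mul_pos hw hpos]
  have hn : 0 < ‖cauchyG μ w‖ ^ 2 := by positivity
  unfold cauchyF
  rw [Complex.inv_im, Complex.normSq_eq_norm_sq, him, neg_neg, le_div_iff₀ hn]
  exact mul_le_mul_of_nonneg_left hsq hw.le

/-- Let `μ̃` be the probability measure with
`F_{μ̃}(z) = F_{μ₃}(w₃(z + 2√2·σ₁·i))` on `ℂ⁺` (with `w₃(ζ)` the fixed point of `T_ζ`).
If `ψ₁, ψ̃, ψ₃` are two-sided inverses of `F_{μ₁}, F_{μ̃}, F_{μ₃}` on `{Im u > c}`, then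
there is `Y > 0` such that for `Im z > Y`, with `u = F_{μ₃}(w₃(z))`,
`ψ₁(u) + ψ̃(u) = ψ₃(u) + u - 2√2·σ₁·i`; i.e. `μ₁ ⊞ μ̃ = μ₃ ⊞ C_{2√2σ₁}`. -/
theorem deconvolution_cauchy_identity (μ₁ μ₃ μt : Measure ℝ)
    [IsProbabilityMeasure μ₁] [IsProbabilityMeasure μ₃] [IsProbabilityMeasure μt]
    (hμ₁mom : Integrable (fun t : ℝ => t ^ 2) μ₁)
    (hμ₃mom : Integrable (fun t : ℝ => t ^ 2) μ₃)
    (σ₁ : ℝ) (hσ₁ : 0 < σ₁)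
    (hmean₁ : (∫ t, t ∂μ₁) = 0)
    (hvar₁ : (∫ t, t ^ 2 ∂μ₁) = σ₁ ^ 2)
    (w₃ : ℂ → ℂ)
    (hw₃ : ∀ ζ : ℂ, 2 * Real.sqrt 2 * σ₁ < ζ.im →
      3 / 4 * ζ.im < (w₃ ζ).im ∧ Tadd μ₁ μ₃ ζ (w₃ ζ) = w₃ ζ)
    (hμt : ∀ z : ℂ, 0 < z.im →
      cauchyF μt z = cauchyF μ₃ (w₃ (z + 2 * Real.sqrt 2 * σ₁ * Complex.I)))
    (c : ℝ) (hc : 0 < c) (ψ₁ ψt ψ₃ : ℂ → ℂ)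
    (hψ₁pos : ∀ u : ℂ, c < u.im → 0 < (ψ₁ u).im)
    (hψtpos : ∀ u : ℂ, c < u.im → 0 < (ψt u).im)
    (hψ₃pos : ∀ u : ℂ, c < u.im → 0 < (ψ₃ u).im)
    (hψ₁right : ∀ u : ℂ, c < u.im → cauchyF μ₁ (ψ₁ u) = u)
    (hψtright : ∀ u : ℂ, c < u.im → cauchyF μt (ψt u) = u)
    (hψ₃right : ∀ u : ℂ, c < u.im → cauchyF μ₃ (ψ₃ u) = u)
    (hψ₁left : ∀ w : ℂ, c < w.im → ψ₁ (cauchyF μ₁ w) = w)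
    (hψtleft : ∀ w : ℂ, c < w.im → ψt (cauchyF μt w) = w)
    (hψ₃left : ∀ w : ℂ, c < w.im → ψ₃ (cauchyF μ₃ w) = w) :
    ∃ Y : ℝ, 0 < Y ∧ ∀ z : ℂ, Y < z.im →
      ψ₁ (cauchyF μ₃ (w₃ z)) + ψt (cauchyF μ₃ (w₃ z)) =
        ψ₃ (cauchyF μ₃ (w₃ z)) + cauchyF μ₃ (w₃ z) -
          2 * Real.sqrt 2 * σ₁ * Complex.I := by
  have hs : 0 < 2 * Real.sqrt 2 * σ₁ := by positivity
  refine ⟨2 * Real.sqrt 2 * σ₁ + 2 * c, by positivity, fun z hz => ?_⟩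
  obtain ⟨h1, h2⟩ := hw₃ z (by linarith)
  have h3 := im_le_im_cauchyF μ₃ (w₃ z) (by linarith)
  have hF : cauchyF μ₁ (cauchyF μ₃ (w₃ z) + w₃ z - z) = cauchyF μ₃ (w₃ z) := by
    unfold Tadd hTrans at h2
    linear_combination -h2
  have e1 := hψ₁left (cauchyF μ₃ (w₃ z) + w₃ z - z) (by
    simp only [Complex.sub_im, Complex.add_im]
    linarith)
  rw [hF] at e1
  have e3 := hψ₃left (w₃ z) (by linarith)
  have him : (z - 2 * Real.sqrt 2 * σ₁ * Complex.I).im = z.im - 2 * Real.sqrt 2 * σ₁ := by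
    simp
  have et := hψtleft (z - 2 * Real.sqrt 2 * σ₁ * Complex.I) (by rw [him]; linarith)
  rw [hμt _ (by rw [him]; linarith), sub_add_cancel] at et
  rw [e1, et, e3]
  ring
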